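/- The quantum determinant of the antiperiodic monodromy matrix is the explicit scalar operator: for all λ ∈ ℂ, B(λ)C(λ−η) − A(λ)D(λ−η) = a(λ)·d(λ−η)·Id_H, where a(λ) = −∏_{n=1}^N (λ − η_n^− + s_n η) and d(λ) = ∏_{n=1}^N (λ − η_n^− − s_n η) with η_n^− = η_n − η/2. -/

import Mathlib

open Matrix BigOperators Finset

noncomputable section

namespace AntiperiodicXXX

/-- `S^z` for the spin-`s` representation with `2s = m`, acting on `ℂ^{m+1}`:
`S^z = diag(s, s-1, …, -s)`. -/
def Sz (m : ℕ) : Matrix (Fin (m + 1)) (Fin (m + 1)) ℂ :=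
  Matrix.diagonal fun i => (m : ℂ) / 2 - (i : ℕ)

/-- `S^+` for spin `s = m/2`: superdiagonal entries `x(j) = √(j(2s+1−j))`. -/
def Splus (m : ℕ) : Matrix (Fin (m + 1)) (Fin (m + 1)) ℂ :=
  Matrix.of fun i j =>
    if (i : ℕ) + 1 = (j : ℕ) then
      ((Real.sqrt (((i : ℕ) + 1) * (m - (i : ℕ))) : ℝ) : ℂ)
    else 0

/-- `S^- = (S^+)^T`. -/
def Sminus (m : ℕ) : Matrix (Fin (m + 1)) (Fin (m + 1)) ℂ := (Splus m)ᵀ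

/-- The Lax operator `L^{(1/2,s)}(λ)` on `ℂ² ⊗ ℂ^{m+1}` in 2×2 block form
`[[λ+η(1/2+S^z), ηS^-], [ηS^+, λ+η(1/2−S^z)]]`. -/
def Lax (η : ℂ) (m : ℕ) (lam : ℂ) :
    Matrix (Fin 2 × Fin (m + 1)) (Fin 2 × Fin (m + 1)) ℂ :=
  Matrix.of fun p q =>
    (![![(lam + η / 2) • (1 : Matrix (Fin (m + 1)) (Fin (m + 1)) ℂ) + η • Sz m,
        η • Sminus m],
       ![η • Splus m,
        (lam + η / 2) • (1 : Matrix (Fin (m + 1)) (Fin (m + 1)) ℂ) - η • Sz m]]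
      p.1 q.1) p.2 q.2

/-- The rational 6-vertex R-matrix `[[λ+η,0,0,0],[0,λ,η,0],[0,η,λ,0],[0,0,0,λ+η]]`
on `ℂ² ⊗ ℂ²`. -/
def Rmat (η lam : ℂ) : Matrix (Fin 2 × Fin 2) (Fin 2 × Fin 2) ℂ :=
  Matrix.of fun p q =>
    if p = q then (if p.1 = p.2 then lam + η else lam)
    else if p.1 = q.2 ∧ p.2 = q.1 ∧ p.1 ≠ p.2 then η else 0

variable {N : ℕ}

/-- Index type of the quantum space `H = ⊗_{n=1}^N ℂ^{2s_n+1}` (with `m n = 2s_n`). -/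
abbrev HIdx (m : Fin N → ℕ) := (n : Fin N) → Fin (m n + 1)

/-- The Lax operator `L^{(1/2,s_n)}_{0n}(λ−η_n)` at site `n` acting on `ℂ² ⊗ H`
(identity on the other tensor factors of `H`). -/
def siteL (η : ℂ) (m : Fin N → ℕ) (inh : Fin N → ℂ) (lam : ℂ) (n : Fin N) :
    Matrix (Fin 2 × HIdx m) (Fin 2 × HIdx m) ℂ :=
  Matrix.of fun p q =>
    Lax η (m n) (lam - inh n) (p.1, p.2 n) (q.1, q.2 n) *
      (if ∀ k, k ≠ n → p.2 k = q.2 k then 1 else 0)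

/-- The monodromy matrix `M₀(λ) = L_{0N}(λ−η_N) ⋯ L_{01}(λ−η₁)` on `ℂ² ⊗ H`. -/
def Mono (η : ℂ) (m : Fin N → ℕ) (inh : Fin N → ℂ) (lam : ℂ) :
    Matrix (Fin 2 × HIdx m) (Fin 2 × HIdx m) ℂ :=
  ((List.ofFn fun n : Fin N => siteL η m inh lam n).reverse).prod

/-- `A(λ)`: entry `(0,0)` of the monodromy matrix. -/
def EntA (η : ℂ) (m : Fin N → ℕ) (inh : Fin N → ℂ) (lam : ℂ) :
    Matrix (HIdx m) (HIdx m) ℂ :=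
  Matrix.of fun f g => Mono η m inh lam (0, f) (0, g)

/-- `B(λ)`: entry `(0,1)` of the monodromy matrix. -/
def EntB (η : ℂ) (m : Fin N → ℕ) (inh : Fin N → ℂ) (lam : ℂ) :
    Matrix (HIdx m) (HIdx m) ℂ :=
  Matrix.of fun f g => Mono η m inh lam (0, f) (1, g)

/-- `C(λ)`: entry `(1,0)` of the monodromy matrix. -/
def EntC (η : ℂ) (m : Fin N → ℕ) (inh : Fin N → ℂ) (lam : ℂ) :
    Matrix (HIdx m) (HIdx m) ℂ :=
  Matrix.of fun f g => Mono η m inh lam (1, f) (0, g)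

/-- `D(λ)`: entry `(1,1)` of the monodromy matrix. -/
def EntD (η : ℂ) (m : Fin N → ℕ) (inh : Fin N → ℂ) (lam : ℂ) :
    Matrix (HIdx m) (HIdx m) ℂ :=
  Matrix.of fun f g => Mono η m inh lam (1, f) (1, g)

/-- The antiperiodic transfer matrix `T̄(λ) = B(λ) + C(λ)`. -/
def Tbar (η : ℂ) (m : Fin N → ℕ) (inh : Fin N → ℂ) (lam : ℂ) :
    Matrix (HIdx m) (HIdx m) ℂ :=
  EntB η m inh lam + EntC η m inh lam

/-- `a(λ) = −∏_{n=1}^N (λ − η_n^− + s_n η)`, with `η_n^− = η_n − η/2`. -/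
def af (η : ℂ) (m : Fin N → ℕ) (inh : Fin N → ℂ) (lam : ℂ) : ℂ :=
  -∏ n, (lam - (inh n - η / 2) + (m n : ℂ) / 2 * η)

/-- `d(λ) = ∏_{n=1}^N (λ − η_n^− − s_n η)`. -/
def df (η : ℂ) (m : Fin N → ℕ) (inh : Fin N → ℂ) (lam : ℂ) : ℂ :=
  ∏ n, (lam - (inh n - η / 2) - (m n : ℂ) / 2 * η)

/-- `η_n^{(k)} = η_n^− + (s_n − k)η`. -/
def etaK (η : ℂ) (m : Fin N → ℕ) (inh : Fin N → ℂ) (n : Fin N) (k : ℕ) : ℂ :=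
  (inh n - η / 2) + ((m n : ℂ) / 2 - (k : ℂ)) * η

/-- The reference state `|0⟩ = ⊗_n (1,0,…,0)^T` (the same components give `⟨0|`). -/
def vac (m : Fin N → ℕ) : HIdx m → ℂ :=
  fun f => if ∀ n, f n = (0 : Fin (m n + 1)) then 1 else 0

/-- The Vandermonde-type coefficient `∏_{1≤b<a≤N} (η_a^{(h_a)} − η_b^{(h_b)})`. -/
def vdm (η : ℂ) (m : Fin N → ℕ) (inh : Fin N → ℂ) (h : HIdx m) : ℂ :=
  ∏ a, ∏ b ∈ Finset.Iio a, (etaK η m inh a (h a) - etaK η m inh b (h b))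

/-- The normalization `𝓃 = ∏_{1≤b<a≤N} (η_a^{(0)} − η_b^{(0)})^{1/2}`. -/
def nrm (η : ℂ) (m : Fin N → ℕ) (inh : Fin N → ℂ) : ℂ :=
  ∏ a, ∏ b ∈ Finset.Iio a, (etaK η m inh a 0 - etaK η m inh b 0) ^ ((1 : ℂ) / 2)

/-- The operator `∏_{n=1}^N ∏_{k_n=0}^{h_n−1} C(η_n^{(k_n)})/d(η_n^{(k_n+1)})`. -/
def leftOp (η : ℂ) (m : Fin N → ℕ) (inh : Fin N → ℂ) (h : HIdx m) :
    Matrix (HIdx m) (HIdx m) ℂ :=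
  (List.ofFn fun n : Fin N =>
    (List.ofFn fun k : Fin (h n : ℕ) =>
      (df η m inh (etaK η m inh n ((k : ℕ) + 1)))⁻¹ •
        EntC η m inh (etaK η m inh n (k : ℕ))).prod).prod

/-- The left SOV covector
`⟨h| = (1/𝓃) ⟨0| ∏_{n=1}^N ∏_{k_n=0}^{h_n−1} C(η_n^{(k_n)})/d(η_n^{(k_n+1)})`. -/
def lvec (η : ℂ) (m : Fin N → ℕ) (inh : Fin N → ℂ) (h : HIdx m) : HIdx m → ℂ :=
  (nrm η m inh)⁻¹ • Matrix.vecMul (vac m) (leftOp η m inh h)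

/-- The operator `∏_{n=1}^N ∏_{k_n=0}^{h_n−1} B(η_n^{(k_n)})/a(η_n^{(k_n)})`. -/
def rightOp (η : ℂ) (m : Fin N → ℕ) (inh : Fin N → ℂ) (h : HIdx m) :
    Matrix (HIdx m) (HIdx m) ℂ :=
  (List.ofFn fun n : Fin N =>
    (List.ofFn fun k : Fin (h n : ℕ) =>
      (af η m inh (etaK η m inh n (k : ℕ)))⁻¹ •
        EntB η m inh (etaK η m inh n (k : ℕ))).prod).prod

/-- The right SOV vector
`|h⟩ = (1/𝓃) ∏_{n=1}^N ∏_{k_n=0}^{h_n−1} [B(η_n^{(k_n)})/a(η_n^{(k_n)})] |0⟩`. -/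
def rvec (η : ℂ) (m : Fin N → ℕ) (inh : Fin N → ℂ) (h : HIdx m) : HIdx m → ℂ :=
  (nrm η m inh)⁻¹ • Matrix.mulVec (rightOp η m inh h) (vac m)

/-- `x + 1`, clamped inside `Fin (d+1)` (the clamped value only ever appears
multiplied by a vanishing coefficient). -/
def upIdx {d : ℕ} (x : Fin (d + 1)) : Fin (d + 1) :=
  if h : (x : ℕ) + 1 ≤ d then ⟨(x : ℕ) + 1, Nat.lt_succ_of_le h⟩ else x

/-- `x − 1`, clamped inside `Fin (d+1)`. -/
def downIdx {d : ℕ} (x : Fin (d + 1)) : Fin (d + 1) :=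
  ⟨(x : ℕ) - 1, lt_of_le_of_lt (Nat.sub_le _ _) x.isLt⟩

/-- `T_a^+(h) = (h₁,…,h_a+1,…,h_N)`. -/
def Tup (m : Fin N → ℕ) (h : HIdx m) (a : Fin N) : HIdx m :=
  Function.update h a (upIdx (h a))

/-- `T_a^-(h) = (h₁,…,h_a−1,…,h_N)`. -/
def Tdown (m : Fin N → ℕ) (h : HIdx m) (a : Fin N) : HIdx m :=
  Function.update h a (downIdx (h a))

/-- The Pauli matrix `σ^x`. -/
def sigmaX : Matrix (Fin 2) (Fin 2) ℂ := !![0, 1; 1, 0]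

/-- `Σ^x`: the `(m+1)×(m+1)` matrix with ones on the antidiagonal. -/
def SigX (m : ℕ) : Matrix (Fin (m + 1)) (Fin (m + 1)) ℂ :=
  Matrix.of fun i j => if (i : ℕ) + (j : ℕ) = m then 1 else 0

/-- `σ^x ⊗ Σ^x` on `ℂ² ⊗ ℂ^{m+1}`. -/
def flip1 (m : ℕ) : Matrix (Fin 2 × Fin (m + 1)) (Fin 2 × Fin (m + 1)) ℂ :=
  Matrix.of fun p q => sigmaX p.1 q.1 * SigX m p.2 q.2

/-- `σ^x₀ ⊗ Σ^x` on `ℂ² ⊗ H`, with `Σ^x = ⊗_{a=1}^N Σ^x_a`. -/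
def bigFlip (m : Fin N → ℕ) : Matrix (Fin 2 × HIdx m) (Fin 2 × HIdx m) ℂ :=
  Matrix.of fun p q => sigmaX p.1 q.1 * ∏ n, SigX (m n) (p.2 n) (q.2 n)

/-- The tridiagonal matrix `D_n(t)` with diagonal `t(η_n^{(i)})`, superdiagonal
`−a(η_n^{(i)})` and subdiagonal `−d(η_n^{(i)})`. -/
def Dmat (η : ℂ) (m : Fin N → ℕ) (inh : Fin N → ℂ) (t : ℂ → ℂ) (n : Fin N) :
    Matrix (Fin (m n + 1)) (Fin (m n + 1)) ℂ :=
  Matrix.of fun i j =>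
    if (i : ℕ) = (j : ℕ) then t (etaK η m inh n i)
    else if (i : ℕ) + 1 = (j : ℕ) then -af η m inh (etaK η m inh n i)
    else if (j : ℕ) + 1 = (i : ℕ) then -df η m inh (etaK η m inh n i)
    else 0

/-- The local lowering operator `S_n^-` acting on the `n`-th factor of `H`. -/
def SnMinus (m : Fin N → ℕ) (n : Fin N) : Matrix (HIdx m) (HIdx m) ℂ :=
  Matrix.of fun f g =>
    Sminus (m n) (f n) (g n) * (if ∀ k, k ≠ n → f k = g k then 1 else 0)

/-- `η̄_n^{(x)} = η_n + (x − s_n − 1/2)η` for (half-integer) `x`. -/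
def etaBar (η : ℂ) (m : Fin N → ℕ) (inh : Fin N → ℂ) (n : Fin N) (x : ℂ) : ℂ :=
  inh n + (x - (m n : ℂ) / 2 - 1 / 2) * η


/-! ### The spin algebra -/

theorem Sminus_mul_Splus (m : ℕ) :
    Sminus m * Splus m = diagonal fun i : Fin (m + 1) => ((i : ℕ) : ℂ) * (m - (i : ℕ) + 1) := by
  ext i j
  simp only [Sminus, mul_apply, transpose_apply, Splus, of_apply, diagonal_apply]
  obtain ⟨i, hi⟩ := i
  cases i with
  | zero => simp
  | succ k =>
    rw [Finset.sum_eq_single ⟨k, by omega⟩]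
    · by_cases h : k + 1 = (j : ℕ)
      · have hk : (k : ℝ) ≤ m := by exact_mod_cast (by omega : k ≤ m)
        have hnn : 0 ≤ ((k : ℝ) + 1) * (m - k) :=
          mul_nonneg (by positivity) (sub_nonneg.2 hk)
        simp only [if_true, h]
        rw [← Complex.ofReal_mul, Real.mul_self_sqrt hnn, ← h]
        push_cast
        ring
      · simp [h, Fin.ext_iff]
    · intro b _ hb
      rw [if_neg, zero_mul]
      intro h
      exact hb (Fin.ext (by simpa using h))
    · simp

theorem Splus_mul_Sminus (m : ℕ) :
    Splus m * Sminus m = diagonal fun i : Fin (m + 1) => ((i : ℕ) + 1 : ℂ) * (m - (i : ℕ)) := by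
  ext i j
  simp only [Sminus, mul_apply, transpose_apply, Splus, of_apply, diagonal_apply]
  have hi : (i : ℕ) ≤ m := Nat.lt_succ_iff.1 i.isLt
  rcases hi.eq_or_lt with h | h
  · rw [Finset.sum_eq_zero]
    · simp [h]
    · intro k _
      rw [if_neg (by omega), zero_mul]
  · rw [Finset.sum_eq_single ⟨i + 1, by omega⟩]
    · by_cases hij : i = j
      · have hi' : ((i : ℕ) : ℝ) ≤ m := by exact_mod_cast hi
        have hnn : 0 ≤ (((i : ℕ) : ℝ) + 1) * (m - (i : ℕ)) :=
          mul_nonneg (by positivity) (sub_nonneg.2 hi')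
        subst hij
        simp only [if_true]
        rw [← Complex.ofReal_mul, Real.mul_self_sqrt hnn]
        push_cast
        ring
      · have : (j : ℕ) ≠ i := fun h => hij (Fin.ext h.symm)
        simp [hij, this]
    · intro b _ hb
      rw [if_neg, zero_mul]
      intro h
      exact hb (Fin.ext h.symm)
    · simp

theorem Sz_mul_Splus (m : ℕ) : Sz m * Splus m = Splus m * Sz m + Splus m := by
  ext i j
  simp only [Sz, diagonal_mul, mul_diagonal, Matrix.add_apply, Splus, of_apply]
  split_ifs with h
  · rw [← h]
    push_cast
    ring
  · simp

theorem Sz_mul_Sminus (m : ℕ) : Sz m * Sminus m = Sminus m * Sz m - Sminus m := by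
  have h := congrArg transpose (Sz_mul_Splus m)
  have hz : (Sz m)ᵀ = Sz m := diagonal_transpose _
  rw [transpose_mul, transpose_add, transpose_mul, hz] at h
  exact eq_sub_of_add_eq h.symm

theorem casimir_Sminus_Splus (m : ℕ) :
    Sminus m * Splus m + Sz m + Sz m * Sz m = ((m : ℂ) / 2 * (m / 2 + 1)) • 1 := by
  rw [Sminus_mul_Splus, Sz, diagonal_mul_diagonal, diagonal_add, diagonal_add,
    smul_one_eq_diagonal]
  congr 1
  ext i
  ring

theorem casimir_Splus_Sminus (m : ℕ) :
    Splus m * Sminus m - Sz m + Sz m * Sz m = ((m : ℂ) / 2 * (m / 2 + 1)) • 1 := by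
  rw [Splus_mul_Sminus, Sz, diagonal_mul_diagonal, diagonal_sub, diagonal_add,
    smul_one_eq_diagonal]
  congr 1
  ext i
  ring

/-! ### The quantum determinant relation for 2×2 matrices over an algebra -/

theorem commute_list_prod {R : Type*} [Ring R] {M : Matrix (Fin 2) (Fin 2) R}
    {l : List (Matrix (Fin 2) (Fin 2) R)}
    (h : ∀ L ∈ l, ∀ i j k k', Commute (M i j) (L k k')) (i j k k' : Fin 2) :
    Commute (M i j) (l.prod k k') := by
  induction l generalizing k k' with
  | nil =>
    rw [List.prod_nil, one_apply]
    split_ifs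
    exacts [Commute.one_right _, Commute.zero_right _]
  | cons L l ih =>
    rw [List.prod_cons, mul_apply, Fin.sum_univ_two]
    have hl := fun k k' => ih (fun L hL => h L (List.mem_cons_of_mem _ hL)) k k'
    have hL := h L List.mem_cons_self
    exact ((hL i j k 0).mul_right (hl 0 k')).add_right ((hL i j k 1).mul_right (hl 1 k'))

section HasQDet

variable {R S : Type*} [Ring R] [Algebra ℂ R] [Ring S] [Algebra ℂ S]

/-- The relation `M ε (M')ᵀ = q ε`, with `ε = [[0, 1], [-1, 0]]`, for 2×2 matrices over a possibly
noncommutative algebra. For `M = M₀(λ)` and `M' = M₀(λ−η)` the scalar `q` is the quantum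
determinant. -/
def HasQDet (M M' : Matrix (Fin 2) (Fin 2) R) (q : ℂ) : Prop :=
  ∀ i j, M i 0 * M' j 1 - M i 1 * M' j 0
    = algebraMap ℂ R (q * (!![0, 1; -1, 0] : Matrix (Fin 2) (Fin 2) ℂ) i j)

theorem hasQDet_one : HasQDet (1 : Matrix (Fin 2) (Fin 2) R) 1 1 := by
  intro i j
  fin_cases i <;> fin_cases j <;> simp [one_apply]

theorem HasQDet.map {M M' : Matrix (Fin 2) (Fin 2) R} {q : ℂ} (h : HasQDet M M' q)
    (φ : R →ₐ[ℂ] S) : HasQDet (M.map φ) (M'.map φ) q := by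
  intro i j
  simp only [map_apply, ← map_mul φ, ← map_sub φ]
  rw [h i j, φ.commutes]

theorem HasQDet.mul {L L' M M' : Matrix (Fin 2) (Fin 2) R} {p q : ℂ} (hL : HasQDet L L' p)
    (hM : HasQDet M M' q) (hcomm : ∀ i j k l, Commute (L' i j) (M k l)) :
    HasQDet (L * M) (L' * M') (p * q) := by
  intro i j
  have key : (L * M) i 0 * (L' * M') j 1 - (L * M) i 1 * (L' * M') j 0
      = L i 0 * L' j 0 * (M 0 0 * M' 0 1 - M 0 1 * M' 0 0)
        + L i 0 * L' j 1 * (M 0 0 * M' 1 1 - M 0 1 * M' 1 0)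
        + L i 1 * L' j 0 * (M 1 0 * M' 0 1 - M 1 1 * M' 0 0)
        + L i 1 * L' j 1 * (M 1 0 * M' 1 1 - M 1 1 * M' 1 0) := by
    have swap : ∀ a b c d : Fin 2, ∀ x y : R,
        x * M a b * (L' c d * y) = x * L' c d * (M a b * y) := fun a b c d x y => by
      rw [mul_assoc, ← mul_assoc (M a b), ← (hcomm c d a b).eq, mul_assoc, mul_assoc]
    simp only [mul_apply, Fin.sum_univ_two, add_mul, mul_add, mul_sub, swap]
    abel
  rw [key, hM 0 0, hM 0 1, hM 1 0, hM 1 1]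
  have e : algebraMap ℂ R (p * q * (!![0, 1; -1, 0] : Matrix (Fin 2) (Fin 2) ℂ) i j)
      = algebraMap ℂ R (p * (!![0, 1; -1, 0] : Matrix (Fin 2) (Fin 2) ℂ) i j)
        * algebraMap ℂ R q := by
    rw [← map_mul]
    congr 1
    ring
  rw [e, ← hL i j]
  rw [sub_mul]
  simp [sub_eq_add_neg]

theorem hasQDet_list_prod {ι : Type*} {L L' : ι → Matrix (Fin 2) (Fin 2) R} {q : ι → ℂ}
    (hq : ∀ n, HasQDet (L n) (L' n) (q n))
    (hcomm : ∀ n n', n ≠ n' → ∀ i j k k', Commute (L' n i j) (L n' k k'))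
    {l : List ι} (hl : l.Nodup) :
    HasQDet (l.map L).prod (l.map L').prod (l.map q).prod := by
  induction l with
  | nil => simpa using hasQDet_one
  | cons n l ih =>
    rw [List.nodup_cons] at hl
    simp only [List.map_cons, List.prod_cons]
    refine (hq n).mul (ih hl.2) (commute_list_prod fun M hM => ?_)
    obtain ⟨n', hn', rfl⟩ := List.mem_map.1 hM
    exact hcomm n n' fun h => hl.1 (h ▸ hn')

end HasQDet

/-! ### Local operators on the quantum space -/

/-- The operator `X_n` acting as `X` on the `n`-th factor of `H` and trivially on the others. -/
def localOp (m : Fin N → ℕ) (n : Fin N) :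
    Matrix (Fin (m n + 1)) (Fin (m n + 1)) ℂ →ₐ[ℂ] Matrix (HIdx m) (HIdx m) ℂ :=
  (reindexAlgEquiv ℂ ℂ (Equiv.piSplitAt n fun k => Fin (m k + 1)).symm).toAlgHom.comp
    (AlgHom.ofLinearMap (LinearMap.flip (kroneckerBilinear (R := ℂ)) 1)
      (by simp [kroneckerBilinear])
      (fun X Y => by simp [kroneckerBilinear, ← mul_kronecker_mul]))

theorem localOp_apply (m : Fin N → ℕ) (n : Fin N)
    (X : Matrix (Fin (m n + 1)) (Fin (m n + 1)) ℂ) (f g : HIdx m) :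
    localOp m n X f g = X (f n) (g n) * if ∀ k, k ≠ n → f k = g k then 1 else 0 := by
  simp [localOp, kroneckerBilinear, one_apply, funext_iff]

theorem localOp_mul_localOp_apply (m : Fin N → ℕ) {n k : Fin N} (hnk : n ≠ k)
    (X : Matrix (Fin (m n + 1)) (Fin (m n + 1)) ℂ)
    (Y : Matrix (Fin (m k + 1)) (Fin (m k + 1)) ℂ) (f g : HIdx m) :
    (localOp m n X * localOp m k Y) f g
      = X (f n) (g n) * Y (f k) (g k) * if ∀ j, j ≠ n → j ≠ k → f j = g j then 1 else 0 := by
  rw [mul_apply, Finset.sum_eq_single (Function.update f n (g n))]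
  · have h₁ : ∀ j, j ≠ n → f j = Function.update f n (g n) j := fun j hj => by simp [hj]
    have h₂ : (∀ j, j ≠ k → Function.update f n (g n) j = g j) ↔
        ∀ j, j ≠ n → j ≠ k → f j = g j := by
      refine forall_congr' fun j => ?_
      by_cases hj : j = n
      · subst hj
        simp
      · simp [hj]
    simp only [localOp_apply, Function.update_self, Function.update_of_ne hnk.symm, if_pos h₁, h₂]
    ring
  · intro h _ hne
    rw [localOp_apply, localOp_apply]
    by_cases h₁ : ∀ j, j ≠ n → f j = h j
    · have h₂ : ¬ ∀ j, j ≠ k → h j = g j := fun h₂ => hne <| by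
        ext1 j
        by_cases hj : j = n
        · subst hj
          simp [h₂ j hnk]
        · simp [hj, h₁ j hj]
      simp [h₂]
    · simp [h₁]
  · simp

theorem commute_localOp (m : Fin N → ℕ) {n k : Fin N} (hnk : n ≠ k)
    (X : Matrix (Fin (m n + 1)) (Fin (m n + 1)) ℂ)
    (Y : Matrix (Fin (m k + 1)) (Fin (m k + 1)) ℂ) :
    Commute (localOp m n X) (localOp m k Y) := by
  ext f g
  rw [localOp_mul_localOp_apply m hnk, localOp_mul_localOp_apply m hnk.symm, mul_comm (X _ _)]
  congr 2
  exact propext (forall_congr' fun j => imp.swap)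

/-! ### Lax operators and the monodromy matrix -/

theorem hasQDet_Lax (η : ℂ) (m : ℕ) (lam : ℂ) :
    HasQDet ((compRingEquiv (Fin 2) (Fin (m + 1)) ℂ).symm (Lax η m lam))
      ((compRingEquiv (Fin 2) (Fin (m + 1)) ℂ).symm (Lax η m (lam - η)))
      ((lam + η / 2 + m / 2 * η) * (lam - η + η / 2 - m / 2 * η)) := by
  have h00 (u : ℂ) : (compRingEquiv (Fin 2) (Fin (m + 1)) ℂ).symm (Lax η m u) 0 0
      = (u + η / 2) • 1 + η • Sz m := rfl
  have h01 (u : ℂ) : (compRingEquiv (Fin 2) (Fin (m + 1)) ℂ).symm (Lax η m u) 0 1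
      = η • Sminus m := rfl
  have h10 (u : ℂ) : (compRingEquiv (Fin 2) (Fin (m + 1)) ℂ).symm (Lax η m u) 1 0
      = η • Splus m := rfl
  have h11 (u : ℂ) : (compRingEquiv (Fin 2) (Fin (m + 1)) ℂ).symm (Lax η m u) 1 1
      = (u + η / 2) • 1 - η • Sz m := rfl
  have hMP : Sminus m * Splus m
      = ((m : ℂ) / 2 * (m / 2 + 1)) • 1 - Sz m * Sz m - Sz m := by
    rw [← casimir_Sminus_Splus]
    abel
  have hPM : Splus m * Sminus m
      = ((m : ℂ) / 2 * (m / 2 + 1)) • 1 - Sz m * Sz m + Sz m := by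
    rw [← casimir_Splus_Sminus]
    abel
  intro i j
  rw [Algebra.algebraMap_eq_smul_one]
  fin_cases i <;> fin_cases j <;>
    simp only [Fin.zero_eta, Fin.mk_one, h00, h01, h10, h11, add_mul, sub_mul, mul_add, mul_sub,
      smul_mul_assoc, mul_smul_comm, one_mul, mul_one, hMP, hPM, Sz_mul_Splus, Sz_mul_Sminus,
      of_apply, cons_val_zero, cons_val_one, cons_val_fin_one, mul_zero, zero_smul] <;>
    module

theorem compRingEquiv_symm_siteL (η : ℂ) (m : Fin N → ℕ) (inh : Fin N → ℂ) (lam : ℂ)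
    (n : Fin N) :
    (compRingEquiv (Fin 2) (HIdx m) ℂ).symm (siteL η m inh lam n)
      = ((compRingEquiv (Fin 2) (Fin (m n + 1)) ℂ).symm (Lax η (m n) (lam - inh n))).map
          (localOp m n) := by
  ext i j f g
  rw [map_apply, localOp_apply]
  rfl

theorem compRingEquiv_symm_Mono (η : ℂ) (m : Fin N → ℕ) (inh : Fin N → ℂ) (lam : ℂ) :
    (compRingEquiv (Fin 2) (HIdx m) ℂ).symm (Mono η m inh lam)
      = ((List.finRange N).reverse.map fun n =>
          (compRingEquiv (Fin 2) (HIdx m) ℂ).symm (siteL η m inh lam n)).prod := by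
  rw [Mono, List.ofFn_eq_map, ← List.map_reverse, map_list_prod, List.map_map]
  rfl

theorem hasQDet_Mono (η : ℂ) (m : Fin N → ℕ) (inh : Fin N → ℂ) (lam : ℂ) :
    HasQDet ((compRingEquiv (Fin 2) (HIdx m) ℂ).symm (Mono η m inh lam))
      ((compRingEquiv (Fin 2) (HIdx m) ℂ).symm (Mono η m inh (lam - η)))
      (-(af η m inh lam * df η m inh (lam - η))) := by
  have hq : -(af η m inh lam * df η m inh (lam - η))
      = ((List.finRange N).reverse.map fun n =>
          (lam - inh n + η / 2 + m n / 2 * η) * (lam - inh n - η + η / 2 - m n / 2 * η)).prod := by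
    rw [List.map_reverse, List.prod_reverse, ← List.ofFn_eq_map, List.prod_ofFn,
      Finset.prod_mul_distrib, af, df, neg_mul, neg_neg]
    congr 1 <;> refine Finset.prod_congr rfl fun n _ => ?_ <;> ring
  rw [hq, compRingEquiv_symm_Mono, compRingEquiv_symm_Mono]
  refine hasQDet_list_prod (fun n => ?_) (fun n n' hn i j k k' => ?_)
    (List.nodup_reverse.2 (List.nodup_finRange N))
  · rw [compRingEquiv_symm_siteL, compRingEquiv_symm_siteL, sub_right_comm lam η]
    exact (hasQDet_Lax η (m n) (lam - inh n)).map (localOp m n)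
  · rw [compRingEquiv_symm_siteL, compRingEquiv_symm_siteL]
    exact commute_localOp m hn _ _

/-- The quantum determinant of the antiperiodic monodromy matrix:
`B(λ)C(λ−η) − A(λ)D(λ−η) = a(λ)d(λ−η)·Id_H` for all `λ ∈ ℂ`. -/
theorem quantum_determinant
    {N : ℕ} (hN : 1 ≤ N) (η : ℂ) (m : Fin N → ℕ) (hm : ∀ n, 1 ≤ m n)
    (inh : Fin N → ℂ) :
    ∀ lam : ℂ,
      EntB η m inh lam * EntC η m inh (lam - η)
          - EntA η m inh lam * EntD η m inh (lam - η)
        = (af η m inh lam * df η m inh (lam - η)) •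
            (1 : Matrix (HIdx m) (HIdx m) ℂ) := by
  intro lam
  have h := hasQDet_Mono η m inh lam 0 1
  rw [Algebra.algebraMap_eq_smul_one] at h
  have h' : EntA η m inh lam * EntD η m inh (lam - η) - EntB η m inh lam * EntC η m inh (lam - η)
      = (-(af η m inh lam * df η m inh (lam - η)) * 1) • 1 := h
  rw [← neg_sub, h', mul_one, neg_smul, neg_neg]
end AntiperiodicXXX
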